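/- arXiv:1605.02843 — 7 statements merged into one kernel-verified Lean document; each statement's English description precedes it below -/
import Mathlib

section
/- For every natural number m ≥ 1 and every real number t, the m-th derivative of the arctangent function satisfies d^m/dt^m arctan(t) = ( (-1)^m (m-1)! / (2 i) ) · ( 1/(t + i)^m - 1/(t - i)^m ), where i is the imaginary unit and the right-hand side is a complex expression whose value is real. -/
open Complex

theorem hasDerivAt_one_div_ofReal_add_pow (n : ℕ) (a : ℂ) (t : ℝ) (h : (t : ℂ) + a ≠ 0) :
    HasDerivAt (fun s : ℝ => 1 / ((s : ℂ) + a) ^ n) (-n * (1 / ((t : ℂ) + a) ^ (n + 1))) t := by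
  have h₁ : HasDerivAt (fun s : ℝ => (s : ℂ) + a) 1 t :=
    (hasDerivAt_id t).ofReal_comp.add_const a
  have h₂ := (h₁.pow n).inv (pow_ne_zero n h)
  simp only [one_div]
  refine h₂.congr_deriv ?_
  cases n with
  | zero => simp
  | succ k =>
    simp only [Pi.pow_apply, Nat.add_sub_cancel]
    field_simp
    ring

theorem ofReal_add_I_ne_zero (t : ℝ) : (t : ℂ) + I ≠ 0 := fun h => by
  simpa using congrArg Complex.im h

theorem ofReal_sub_I_ne_zero (t : ℝ) : (t : ℂ) - I ≠ 0 := fun h => by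
  simpa using congrArg Complex.im h

theorem iteratedDeriv_arctan_formula (m : ℕ) (hm : 1 ≤ m) (t : ℝ) :
    ((iteratedDeriv m Real.arctan t : ℝ) : ℂ) =
      ((-1) ^ m * ((m - 1).factorial : ℂ) / (2 * I)) *
        (1 / ((t : ℂ) + I) ^ m - 1 / ((t : ℂ) - I) ^ m) := by
  induction m, hm using Nat.le_induction generalizing t with
  | base =>
    have h₁ := ofReal_add_I_ne_zero t
    have h₂ := ofReal_sub_I_ne_zero t
    have h₃ : (1 : ℂ) + (t : ℂ) ^ 2 = (t + I) * (t - I) := by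
      linear_combination I_sq
    rw [iteratedDeriv_one, Real.deriv_arctan]
    push_cast
    rw [h₃]
    field_simp
    simp
    ring
  | succ n hn ih =>
    have hd : DifferentiableAt ℝ (iteratedDeriv n Real.arctan) t :=
      (Real.contDiff_arctan (n := (n + 1 : ℕ))).differentiable_iteratedDeriv n
        (by exact_mod_cast n.lt_succ_self) t
    have h₁ := hd.hasDerivAt.ofReal_comp
    rw [← iteratedDeriv_succ, funext ih] at h₁
    have h₂ := hasDerivAt_one_div_ofReal_add_pow n I t (ofReal_add_I_ne_zero t)
    have h₃ := hasDerivAt_one_div_ofReal_add_pow n (-I) t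
      (by simpa [sub_eq_add_neg] using ofReal_sub_I_ne_zero t)
    simp only [← sub_eq_add_neg] at h₃
    rw [h₁.unique ((h₂.sub h₃).const_mul _)]
    obtain ⟨k, rfl⟩ := Nat.exists_eq_add_of_le' hn
    simp only [Nat.add_sub_cancel, Nat.factorial_succ]
    push_cast
    ring
end

section
/- For every natural number m ≥ 1 and all real numbers x and t, the m-th partial derivative with respect to t of the function t ↦ arctan(x t) satisfies ∂^m/∂t^m arctan(x t) = ( (-1)^m (m-1)! x^m / (2 i) ) · ( 1/(x t + i)^m - 1/(x t - i)^m ), where i is the imaginary unit. -/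
open Complex

theorem hasDerivAt_one_div_ofReal_mul_add_pow (n : ℕ) (x t : ℝ) (c : ℂ)
    (h : (x : ℂ) * (t : ℂ) + c ≠ 0) :
    HasDerivAt (fun s : ℝ => 1 / ((x : ℂ) * (s : ℂ) + c) ^ n)
      (-(n : ℂ) * x / ((x : ℂ) * (t : ℂ) + c) ^ (n + 1)) t := by
  have h₁ : HasDerivAt (fun s : ℝ => (x : ℂ) * (s : ℂ) + c) (x : ℂ) t := by
    simpa using ((hasDerivAt_id t).ofReal_comp.const_mul (x : ℂ)).add_const c
  have h₂ := (h₁.fun_pow n).fun_inv (pow_ne_zero n h)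
  simp only [one_div]
  refine h₂.congr_deriv ?_
  rcases n with _ | n
  · simp
  · rw [Nat.add_sub_cancel]
    field_simp
    ring

theorem ofReal_mul_add_ne_zero_of_im_ne_zero (x t : ℝ) {c : ℂ} (hc : c.im ≠ 0) :
    (x : ℂ) * (t : ℂ) + c ≠ 0 := fun h => hc (by simpa using congrArg Complex.im h)

theorem iteratedDeriv_succ_arctan_mul (n : ℕ) (x t : ℝ) :
    ((iteratedDeriv (n + 1) (fun t : ℝ => Real.arctan (x * t)) t : ℝ) : ℂ) =
      ((-1) ^ (n + 1) * (n.factorial : ℂ) * (x : ℂ) ^ (n + 1) / (2 * I)) *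
        (1 / ((x : ℂ) * (t : ℂ) + I) ^ (n + 1) - 1 / ((x : ℂ) * (t : ℂ) + -I) ^ (n + 1)) := by
  have hp (s : ℝ) : (x : ℂ) * (s : ℂ) + I ≠ 0 :=
    ofReal_mul_add_ne_zero_of_im_ne_zero x s (by simp)
  have hm (s : ℝ) : (x : ℂ) * (s : ℂ) + -I ≠ 0 :=
    ofReal_mul_add_ne_zero_of_im_ne_zero x s (by simp)
  induction n generalizing t with
  | zero =>
    have hd : HasDerivAt (fun t : ℝ => Real.arctan (x * t)) (1 / (1 + (x * t) ^ 2) * x) t := by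
      simpa using ((hasDerivAt_id t).const_mul x).arctan
    have hq : (1 : ℂ) + (x * t) ^ 2 = (x * t + I) * (x * t + -I) := by
      linear_combination I_sq
    rw [zero_add, iteratedDeriv_one, hd.deriv]
    push_cast
    rw [hq]
    have := hp t
    have := hm t
    have := I_ne_zero
    field_simp
    simp
    ring
  | succ n ih =>
    have hc : ContDiff ℝ (n + 2 : ℕ) (fun t : ℝ => Real.arctan (x * t)) :=
      (contDiff_const.mul contDiff_id).arctan
    have hd := ((hc.differentiable_iteratedDeriv (n + 1)
      (by exact_mod_cast Nat.lt_succ_self (n + 1))) t).hasDerivAt.ofReal_comp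
    rw [← iteratedDeriv_succ, funext ih] at hd
    rw [hd.unique (((hasDerivAt_one_div_ofReal_mul_add_pow (n + 1) x t I (hp t)).fun_sub
      (hasDerivAt_one_div_ofReal_mul_add_pow (n + 1) x t (-I) (hm t))).const_mul _),
      Nat.factorial_succ]
    push_cast
    ring

theorem iteratedDeriv_arctan_mul_formula (m : ℕ) (hm : 1 ≤ m) (x t : ℝ) :
    ((iteratedDeriv m (fun t : ℝ => Real.arctan (x * t)) t : ℝ) : ℂ) =
      ((-1) ^ m * ((m - 1).factorial : ℂ) * (x : ℂ) ^ m / (2 * I)) *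
        (1 / ((x : ℂ) * (t : ℂ) + I) ^ m - 1 / ((x : ℂ) * (t : ℂ) - I) ^ m) := by
  obtain ⟨n, rfl⟩ := Nat.exists_eq_add_of_le' hm
  simpa only [Nat.add_sub_cancel, sub_eq_add_neg] using iteratedDeriv_succ_arctan_mul n x t
end

section
/- (Adegoke–Layeni–Lampret formula) For every natural number m ≥ 1 and every real number t, d^m/dt^m arctan(t) = sgn(-t)^(m-1) · ( (m-1)! / (1 + t²)^(m/2) ) · sin( m · arcsin( 1/√(1 + t²) ) ), where sgn(t) equals 1 if t ≥ 0 and equals -1 if t < 0. -/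
theorem hasDerivAt_sin_mul_sin_pow_arctan (n : ℕ) (t : ℝ) :
    HasDerivAt
      (fun t : ℝ => (-1 : ℝ) ^ n * n.factorial *
        (Real.sin ((n + 1 : ℕ) * (Real.pi / 2 - Real.arctan t)) *
          Real.sin (Real.pi / 2 - Real.arctan t) ^ (n + 1)))
      ((-1 : ℝ) ^ (n + 1) * (n + 1).factorial *
        (Real.sin ((n + 1 + 1 : ℕ) * (Real.pi / 2 - Real.arctan t)) *
          Real.sin (Real.pi / 2 - Real.arctan t) ^ (n + 1 + 1))) t := by
  have hφ : HasDerivAt (fun t : ℝ => Real.pi / 2 - Real.arctan t)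
      (-Real.sin (Real.pi / 2 - Real.arctan t) ^ 2) t := by
    have h := (Real.hasDerivAt_arctan t).const_sub (Real.pi / 2)
    rwa [← Real.cos_sq_arctan, ← Real.sin_pi_div_two_sub] at h
  refine (((hφ.const_mul ((n + 1 : ℕ) : ℝ)).sin.mul (hφ.sin.pow (n + 1))).const_mul
    ((-1 : ℝ) ^ n * n.factorial)).congr_deriv ?_
  rw [Pi.pow_apply]
  generalize Real.pi / 2 - Real.arctan t = φ
  have hsin : Real.sin ((n + 1 + 1 : ℕ) * φ) =
      Real.sin ((n + 1 : ℕ) * φ) * Real.cos φ + Real.cos ((n + 1 : ℕ) * φ) * Real.sin φ := by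
    rw [← Real.sin_add]
    push_cast
    ring_nf
  rw [hsin, Nat.factorial_succ, Nat.add_sub_cancel]
  push_cast
  ring

theorem iteratedDeriv_succ_arctan (n : ℕ) :
    iteratedDeriv (n + 1) Real.arctan = fun t : ℝ => (-1 : ℝ) ^ n * n.factorial *
      (Real.sin ((n + 1 : ℕ) * (Real.pi / 2 - Real.arctan t)) *
        Real.sin (Real.pi / 2 - Real.arctan t) ^ (n + 1)) := by
  induction n with
  | zero =>
    ext t
    rw [iteratedDeriv_one, (Real.hasDerivAt_arctan t).deriv, ← Real.cos_sq_arctan]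
    simp [Real.sin_pi_div_two_sub, sq]
  | succ n ih =>
    ext t
    rw [iteratedDeriv_succ, ih]
    exact (hasDerivAt_sin_mul_sin_pow_arctan n t).deriv

theorem arcsin_one_div_sqrt_one_add_sq (t : ℝ) :
    Real.arcsin (1 / Real.sqrt (1 + t ^ 2)) = Real.pi / 2 - |Real.arctan t| := by
  have hlt : |Real.arctan t| < Real.pi / 2 :=
    abs_lt.2 ⟨Real.neg_pi_div_two_lt_arctan t, Real.arctan_lt_pi_div_two t⟩
  have hpos := abs_nonneg (Real.arctan t)
  rw [← Real.cos_arctan, ← Real.cos_abs, ← Real.sin_pi_div_two_sub]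
  exact Real.arcsin_sin (by linarith) (by linarith)

theorem adegoke_layeni_lampret (m : ℕ) (hm : 1 ≤ m) (t : ℝ) :
    iteratedDeriv m Real.arctan t =
      (if 0 ≤ -t then (1 : ℝ) else -1) ^ (m - 1) *
        ((m - 1).factorial / (1 + t ^ 2) ^ ((m : ℝ) / 2)) *
        Real.sin (m * Real.arcsin (1 / Real.sqrt (1 + t ^ 2))) := by
  obtain ⟨n, rfl⟩ : ∃ n, m = n + 1 := ⟨m - 1, by omega⟩
  rw [iteratedDeriv_succ_arctan, arcsin_one_div_sqrt_one_add_sq,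
    Real.rpow_div_two_eq_sqrt _ (by positivity), Real.rpow_natCast, Nat.add_sub_cancel]
  simp only [Real.sin_pi_div_two_sub, Real.cos_arctan]
  split_ifs with ht
  · have harg : ((n + 1 : ℕ) : ℝ) * (Real.pi / 2 - |Real.arctan t|) =
        (n + 1 : ℕ) * Real.pi - (n + 1 : ℕ) * (Real.pi / 2 - Real.arctan t) := by
      rw [abs_of_nonpos (Real.arctan_le_zero.2 (by linarith))]
      ring
    rw [harg, Real.sin_nat_mul_pi_sub, one_div, inv_pow, one_pow]
    ring
  · rw [abs_of_nonneg (Real.arctan_nonneg.2 (by linarith)), one_div, inv_pow]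
    ring
end

section
/- Let M ≥ 0 be a fixed natural number and let f : ℝ → ℝ be infinitely differentiable. Then ∫₀¹ f(t) dt = lim_{L→∞} 2 · Σ_{ℓ=1}^{L} Σ_{m=1}^{⌊M/2⌋+1} ( 1 / ( (2L)^(2m-1) (2m-1)! ) ) · f^(2m-2)( (ℓ - 1/2)/L ), where the limit is taken over positive integers L. -/
open Filter Topology

/-- Midpoint Riemann sums of a continuous function converge to its integral over `[0, 1]`. -/
theorem tendsto_midpoint_sum {g : ℝ → ℝ} (hg : Continuous g) :
    Tendsto (fun L : ℕ => (1 / (L : ℝ)) * ∑ ℓ ∈ Finset.Icc 1 L, g (((ℓ : ℝ) - 1 / 2) / (L : ℝ)))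
      atTop (𝓝 (∫ t in (0 : ℝ)..1, g t)) := by
  rw [Metric.tendsto_atTop]
  intro ε hε
  have huc : UniformContinuousOn g (Set.Icc 0 1) :=
    isCompact_Icc.uniformContinuousOn_of_continuous hg.continuousOn
  obtain ⟨δ, hδ, hgδ⟩ := Metric.uniformContinuousOn_iff.1 huc (ε / 2) (half_pos hε)
  obtain ⟨N, hN⟩ := exists_nat_gt (1 / δ)
  refine ⟨N, fun L hL => ?_⟩
  have hL1 : 1 / δ < (L : ℝ) := hN.trans_le (by exact_mod_cast hL)
  have hLpos : (0 : ℝ) < L := (one_div_pos.2 hδ).trans hL1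
  have hLδ : 1 / (L : ℝ) < δ := (one_div_lt hδ hLpos).1 hL1
  have hsplit : ∫ t in (0 : ℝ)..1, g t =
      ∑ i ∈ Finset.range L, ∫ t in ((i : ℝ) / L)..(((i + 1 : ℕ) : ℝ) / L), g t := by
    rw [intervalIntegral.sum_integral_adjacent_intervals (a := fun i : ℕ => (i : ℝ) / L)
      (fun k _ => hg.intervalIntegrable _ _)]
    simp [hLpos.ne']
  have hshift : ∑ ℓ ∈ Finset.Icc 1 L, g (((ℓ : ℝ) - 1 / 2) / (L : ℝ)) =
      ∑ i ∈ Finset.range L, g (((i : ℝ) + 1 / 2) / L) := by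
    rw [Finset.range_eq_Ico, ← Finset.Ico_add_one_right_eq_Icc, ← Finset.sum_Ico_add' _ 0 L 1]
    refine Finset.sum_congr rfl fun i _ => ?_
    push_cast
    congr 2
    ring
  have hcell : ∀ i ∈ Finset.range L,
      ‖(1 / (L : ℝ)) * g (((i : ℝ) + 1 / 2) / L) -
        ∫ t in ((i : ℝ) / L)..(((i + 1 : ℕ) : ℝ) / L), g t‖ ≤ ε / 2 * (1 / L) := by
    intro i hi
    have hiL : (i : ℝ) + 1 ≤ L := by exact_mod_cast Finset.mem_range.1 hi
    have hi0 : (0 : ℝ) ≤ i := i.cast_nonneg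
    have hlen : ((i + 1 : ℕ) : ℝ) / L - (i : ℝ) / L = 1 / L := by push_cast; ring
    have hle : (i : ℝ) / L ≤ ((i + 1 : ℕ) : ℝ) / L := by
      have : 0 < 1 / (L : ℝ) := by positivity
      linarith
    have hconst : (1 / (L : ℝ)) * g (((i : ℝ) + 1 / 2) / L) =
        ∫ _ in ((i : ℝ) / L)..(((i + 1 : ℕ) : ℝ) / L), g (((i : ℝ) + 1 / 2) / L) := by
      rw [intervalIntegral.integral_const, hlen, smul_eq_mul]
    rw [hconst, ← intervalIntegral.integral_sub intervalIntegrable_const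
      (hg.intervalIntegrable _ _)]
    refine (intervalIntegral.norm_integral_le_of_norm_le_const (C := ε / 2) ?_).trans_eq ?_
    · intro t ht
      rw [Set.uIoc_of_le hle] at ht
      obtain ⟨ht1, ht2⟩ := ht
      have h1 : (i : ℝ) < t * L := (div_lt_iff₀ hLpos).1 ht1
      have h2 : t * L ≤ i + 1 := by
        have := (le_div_iff₀ hLpos).1 ht2
        push_cast at this
        exact this
      have ht0 : 0 ≤ t := (div_nonneg hi0 hLpos.le).trans ht1.le
      have ht1' : t ≤ 1 := by
        by_contra! h
        nlinarith
      have hc0 : 0 ≤ ((i : ℝ) + 1 / 2) / L := by positivity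
      have hc1 : ((i : ℝ) + 1 / 2) / L ≤ 1 := by
        rw [div_le_one hLpos]
        linarith
      rw [← dist_eq_norm]
      refine (hgδ _ ⟨hc0, hc1⟩ _ ⟨ht0, ht1'⟩ ?_).le
      refine lt_of_le_of_lt ?_ hLδ
      have he : ((i : ℝ) + 1 / 2) / L - t = ((i : ℝ) + 1 / 2 - t * L) / L := by
        field_simp
      rw [Real.dist_eq, he, abs_div, abs_of_pos hLpos]
      gcongr
      rw [abs_le]
      constructor <;> linarith
    · rw [hlen, abs_of_pos (by positivity)]
  rw [dist_eq_norm, hshift, hsplit, Finset.mul_sum, ← Finset.sum_sub_distrib]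
  refine (norm_sum_le_of_le _ hcell).trans_lt ?_
  rw [Finset.sum_const, Finset.card_range, nsmul_eq_mul]
  field_simp
  linarith

theorem integral_eq_lim_even_derivs (M : ℕ) (f : ℝ → ℝ) (hf : ContDiff ℝ (⊤ : ℕ∞) f) :
    Tendsto
      (fun L : ℕ =>
        2 * ∑ ℓ ∈ Finset.Icc 1 L, ∑ m ∈ Finset.Icc 1 (M / 2 + 1),
          (1 / ((2 * (L : ℝ)) ^ (2 * m - 1) * ((2 * m - 1).factorial : ℝ))) *
            iteratedDeriv (2 * m - 2) f (((ℓ : ℝ) - 1 / 2) / (L : ℝ)))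
      atTop (𝓝 (∫ t in (0 : ℝ)..1, f t)) := by
  have hmean (k : ℕ) := tendsto_midpoint_sum
    (hf.continuous_iteratedDeriv k (by exact_mod_cast le_top))
  have hinv : Tendsto (fun L : ℕ => 1 / (2 * (L : ℝ))) atTop (𝓝 0) := by
    have := (tendsto_one_div_atTop_nhds_zero_nat (𝕜 := ℝ)).const_mul (1 / 2)
    rw [mul_zero] at this
    refine this.congr fun L => ?_
    rw [one_div_mul_one_div]
  have hterm (m : ℕ) := ((hinv.pow (2 * m)).mul_const
    (1 / ((2 * m + 1).factorial : ℝ))).mul (hmean (2 * m))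
  have hsum := tendsto_finsetSum (Finset.range (M / 2 + 1)) fun m _ => hterm m
  have hlim : ∑ m ∈ Finset.range (M / 2 + 1), (0 : ℝ) ^ (2 * m) * (1 / ((2 * m + 1).factorial : ℝ)) *
      ∫ t in (0 : ℝ)..1, iteratedDeriv (2 * m) f t = ∫ t in (0 : ℝ)..1, f t := by
    rw [Finset.sum_eq_single_of_mem 0 (by simp)]
    · simp
    · intro m _ hm
      simp [hm]
  rw [hlim] at hsum
  refine hsum.congr fun L => ?_
  rw [Finset.sum_comm, Finset.mul_sum, ← Finset.Ico_add_one_right_eq_Icc 1 (M / 2 + 1),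
    ← Finset.sum_Ico_add' _ 0 (M / 2 + 1) 1, Finset.range_eq_Ico]
  refine Finset.sum_congr rfl fun m _ => ?_
  rw [show 2 * (m + 1) - 1 = 2 * m + 1 by omega, show 2 * (m + 1) - 2 = 2 * m by omega,
    ← Finset.mul_sum, ← mul_assoc, ← mul_assoc]
  congr 1
  rw [pow_succ, div_pow, one_pow]
  simp only [one_div, mul_inv]
  ring
end

section
/- Let M ≥ 0 be a fixed natural number and x a real number. Then arctan(x) = lim_{L→∞} 2 · Σ_{ℓ=1}^{L} Σ_{m=1}^{⌊M/2⌋+1} ( 1 / ( (2L)^(2m-1) (2m-1)! ) ) · [ ∂^(2m-1)/∂t^(2m-1) arctan(x t) evaluated at t = (ℓ - 1/2)/L ], where the limit is taken over positive integers L. -/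
open Filter Topology

/-- Midpoint Riemann sums of the derivative of a `C¹` function on `[0, 1]` converge to its
increment. -/
theorem tendsto_midpoint_sum_deriv {f : ℝ → ℝ} (hf : ContDiff ℝ 1 f) :
    Tendsto
      (fun L : ℕ => (L : ℝ)⁻¹ * ∑ ℓ ∈ Finset.Icc 1 L, deriv f (((ℓ : ℝ) - 1 / 2) / (L : ℝ)))
      atTop (𝓝 (f 1 - f 0)) := by
  have huc : UniformContinuousOn (deriv f) (Set.Icc 0 1) :=
    isCompact_Icc.uniformContinuousOn_of_continuous (hf.continuous_deriv le_rfl).continuousOn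
  rw [Metric.tendsto_atTop]
  intro ε hε
  obtain ⟨δ, hδ, hclose⟩ := Metric.uniformContinuousOn_iff.1 huc (ε / 2) (half_pos hε)
  obtain ⟨N, hN⟩ := exists_nat_gt δ⁻¹
  refine ⟨N + 1, fun L hL => ?_⟩
  have hLpos : (0 : ℝ) < L := by exact_mod_cast (by omega : 0 < L)
  have hLδ : (L : ℝ)⁻¹ < δ := by
    refine inv_lt_of_inv_lt₀ hδ (hN.trans ?_)
    exact_mod_cast (by omega : N < L)
  have htel : f 1 - f 0 =
      ∑ i ∈ Finset.range L, (f (((i + 1 : ℕ) : ℝ) / L) - f ((i : ℝ) / L)) := by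
    rw [Finset.sum_range_sub (fun i : ℕ => f ((i : ℝ) / L))]
    simp [hLpos.ne']
  have hshift : ∑ ℓ ∈ Finset.Icc 1 L, deriv f (((ℓ : ℝ) - 1 / 2) / (L : ℝ)) =
      ∑ i ∈ Finset.range L, deriv f ((((i + 1 : ℕ) : ℝ) - 1 / 2) / (L : ℝ)) := by
    rw [Finset.range_eq_Ico, Finset.sum_Ico_add' (fun ℓ : ℕ => deriv f (((ℓ : ℝ) - 1 / 2) / L))]
    rfl
  have hterm : ∀ i ∈ Finset.range L,
      ‖(L : ℝ)⁻¹ * deriv f ((((i + 1 : ℕ) : ℝ) - 1 / 2) / (L : ℝ)) -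
        (f (((i + 1 : ℕ) : ℝ) / L) - f ((i : ℝ) / L))‖ ≤ (L : ℝ)⁻¹ * (ε / 2) := by
    intro i hi
    have hiL : (i : ℝ) + 1 ≤ L := by exact_mod_cast Finset.mem_range.1 hi
    have hi0 : (0 : ℝ) ≤ i := Nat.cast_nonneg i
    push_cast
    have hlt : (i : ℝ) / L < ((i : ℝ) + 1) / L := by gcongr; linarith
    obtain ⟨ξ, ⟨hξ₁, hξ₂⟩, hξ⟩ := exists_deriv_eq_slope f hlt hf.continuous.continuousOn
      (hf.differentiable one_ne_zero).differentiableOn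
    have hwidth : ((i : ℝ) + 1) / L - i / L = (L : ℝ)⁻¹ := by field_simp; ring
    have hincr : f (((i : ℝ) + 1) / L) - f (i / L) = (L : ℝ)⁻¹ * deriv f ξ := by
      rw [hξ, hwidth]; field_simp
    have hmid₁ : (i : ℝ) / L ≤ ((i : ℝ) + 1 - 1 / 2) / L := by gcongr; linarith
    have hmid₂ : ((i : ℝ) + 1 - 1 / 2) / L ≤ ((i : ℝ) + 1) / L := by gcongr; linarith
    have hleft : 0 ≤ (i : ℝ) / L := by positivity
    have hright : ((i : ℝ) + 1) / L ≤ 1 := (div_le_one hLpos).2 hiL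
    have hdist : dist (((i : ℝ) + 1 - 1 / 2) / L) ξ < δ := by
      rw [Real.dist_eq, abs_lt]
      constructor <;> linarith
    have := hclose _ ⟨hleft.trans hmid₁, hmid₂.trans hright⟩ ξ
      ⟨hleft.trans hξ₁.le, hξ₂.le.trans hright⟩ hdist
    rw [hincr, ← mul_sub, norm_mul, Real.norm_of_nonneg (inv_nonneg.2 hLpos.le), ← dist_eq_norm]
    gcongr
  rw [dist_eq_norm, htel, hshift, Finset.mul_sum, ← Finset.sum_sub_distrib]
  calc _ ≤ ∑ i ∈ Finset.range L, (L : ℝ)⁻¹ * (ε / 2) := norm_sum_le_of_le _ hterm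
    _ = ε / 2 := by
      rw [Finset.sum_const, Finset.card_range, nsmul_eq_mul, mul_inv_cancel_left₀ hLpos.ne']
    _ < ε := half_lt_self hε

/-- The contribution of order `n + 1` to the midpoint Taylor expansion of `f 1 - f 0` vanishes in
the limit unless `n = 0`. -/
theorem tendsto_midpoint_sum_iteratedDeriv {f : ℝ → ℝ} {n : ℕ}
    (hf : ContDiff ℝ (1 + n : ℕ) f) :
    Tendsto
      (fun L : ℕ => 2 * ∑ ℓ ∈ Finset.Icc 1 L,
        (1 / ((2 * (L : ℝ)) ^ (n + 1) * ((n + 1).factorial : ℝ))) *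
          iteratedDeriv (n + 1) f (((ℓ : ℝ) - 1 / 2) / (L : ℝ)))
      atTop (𝓝 (if n = 0 then f 1 - f 0 else 0)) := by
  have hn : ContDiff ℝ 1 (iteratedDeriv n f) := by
    rw [iteratedDeriv_eq_iterate]
    exact ContDiff.iterate_deriv' 1 n hf
  have hsum := tendsto_midpoint_sum_deriv hn
  have hpow : Tendsto (fun L : ℕ => (2 / (2 ^ (n + 1) * ((n + 1).factorial : ℝ))) *
      ((L : ℝ)⁻¹) ^ n) atTop (𝓝 ((2 / (2 ^ (n + 1) * ((n + 1).factorial : ℝ))) * 0 ^ n)) :=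
    (tendsto_inv_atTop_nhds_zero_nat.pow n).const_mul _
  have hlim := hpow.mul hsum
  have hval : (2 / (2 ^ (n + 1) * ((n + 1).factorial : ℝ))) * 0 ^ n *
      (iteratedDeriv n f 1 - iteratedDeriv n f 0) = if n = 0 then f 1 - f 0 else 0 := by
    split_ifs with h
    · subst h; simp
    · simp [h]
  rw [hval] at hlim
  refine hlim.congr fun L => ?_
  rw [iteratedDeriv_succ, ← Finset.mul_sum, mul_pow, pow_succ (L : ℝ)]
  simp only [div_eq_mul_inv, mul_inv, inv_pow]
  ring

theorem arctan_eq_lim_arctan_derivs (M : ℕ) (x : ℝ) :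
    Tendsto
      (fun L : ℕ =>
        2 * ∑ ℓ ∈ Finset.Icc 1 L, ∑ m ∈ Finset.Icc 1 (M / 2 + 1),
          (1 / ((2 * (L : ℝ)) ^ (2 * m - 1) * ((2 * m - 1).factorial : ℝ))) *
            iteratedDeriv (2 * m - 1) (fun t : ℝ => Real.arctan (x * t))
              (((ℓ : ℝ) - 1 / 2) / (L : ℝ)))
      atTop (𝓝 (Real.arctan x)) := by
  have hf (k : ℕ) : ContDiff ℝ k (fun t : ℝ => Real.arctan (x * t)) :=
    Real.contDiff_arctan.comp (contDiff_const.mul contDiff_id)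
  have hlim := tendsto_finsetSum (Finset.Icc 1 (M / 2 + 1)) fun m _ =>
    tendsto_midpoint_sum_iteratedDeriv (hf (1 + (2 * m - 2)))
  have hval : ∑ m ∈ Finset.Icc 1 (M / 2 + 1), (if 2 * m - 2 = 0 then
      Real.arctan (x * 1) - Real.arctan (x * 0) else 0) = Real.arctan x := by
    rw [Finset.sum_eq_single_of_mem 1 (by simp)]
    · simp
    · intro m hm hm1
      rw [Finset.mem_Icc] at hm
      exact if_neg (by omega)
  rw [hval] at hlim
  refine hlim.congr fun L => ?_
  rw [Finset.sum_comm, Finset.mul_sum]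
  refine Finset.sum_congr rfl fun m hm => ?_
  have hm' : 2 * m - 2 + 1 = 2 * m - 1 := by
    rw [Finset.mem_Icc] at hm
    omega
  rw [hm']
end

section
/- Let M ≥ 0 be a fixed natural number and x a nonzero real number. Then arctan(x) = lim_{L→∞} i · Σ_{ℓ=1}^{L} Σ_{m=1}^{⌊M/2⌋+1} ( 1/(2m-1) ) · ( 1/((2ℓ-1) + 2 i L / x)^(2m-1) - 1/((2ℓ-1) - 2 i L / x)^(2m-1) ), where i is the imaginary unit, the limit is taken over positive integers L, and the convergence is in ℂ to the real number arctan(x) embedded in ℂ. -/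
open Filter Topology Complex

theorem abs_div_one_add_sq_sub_le (x s t : ℝ) :
    |x / (1 + (x * s) ^ 2) - x / (1 + (x * t) ^ 2)| ≤ x ^ 2 * |s - t| := by
  have hs : 0 < 1 + (x * s) ^ 2 := by positivity
  have ht : 0 < 1 + (x * t) ^ 2 := by positivity
  have key : |x * s + x * t| ≤ (1 + (x * s) ^ 2) * (1 + (x * t) ^ 2) := by
    rw [abs_le]
    constructor <;>
      nlinarith [sq_nonneg (x * s + 1), sq_nonneg (x * t + 1), sq_nonneg (x * s - 1),
        sq_nonneg (x * t - 1), sq_nonneg (x * s * (x * t))]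
  have e : x / (1 + (x * s) ^ 2) - x / (1 + (x * t) ^ 2) =
      x ^ 2 * (t - s) * ((x * s + x * t) / ((1 + (x * s) ^ 2) * (1 + (x * t) ^ 2))) := by
    field_simp
    ring
  have hle : |(x * s + x * t) / ((1 + (x * s) ^ 2) * (1 + (x * t) ^ 2))| ≤ 1 := by
    rw [abs_div, abs_of_pos (mul_pos hs ht)]
    exact (div_le_one (mul_pos hs ht)).2 key
  rw [e, abs_mul, abs_mul, abs_of_nonneg (sq_nonneg x), abs_sub_comm t s]
  exact mul_le_of_le_one_right (by positivity) hle

theorem abs_arctan_sub_sub_le (x a b t : ℝ) (hab : a < b) (ht : t ∈ Set.Icc a b) :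
    |(b - a) * (x / (1 + (x * t) ^ 2)) - (Real.arctan (x * b) - Real.arctan (x * a))| ≤
      x ^ 2 * (b - a) ^ 2 := by
  have hd (u : ℝ) : HasDerivAt (fun u => Real.arctan (x * u)) (x / (1 + (x * u) ^ 2)) u := by
    have h := ((hasDerivAt_id u).const_mul x).arctan
    simp only [id, mul_one] at h
    convert h using 1
    ring
  obtain ⟨c, hc, h⟩ := exists_hasDerivAt_eq_slope (fun u => Real.arctan (x * u))
    (fun u => x / (1 + (x * u) ^ 2)) hab
    (fun u _ => (hd u).continuousAt.continuousWithinAt) (fun u _ => hd u)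
  have hba : 0 < b - a := sub_pos.2 hab
  rw [eq_div_iff hba.ne'] at h
  rw [← h, mul_comm (x / (1 + (x * c) ^ 2)), ← mul_sub, abs_mul, abs_of_pos hba]
  have htc : |t - c| ≤ b - a := by
    rw [abs_le]
    constructor <;> linarith [hc.1, hc.2, ht.1, ht.2]
  calc (b - a) * |x / (1 + (x * t) ^ 2) - x / (1 + (x * c) ^ 2)|
      ≤ (b - a) * (x ^ 2 * (b - a)) := by
        gcongr
        exact (abs_div_one_add_sq_sub_le x t c).trans (by gcongr)
    _ = x ^ 2 * (b - a) ^ 2 := by ring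

theorem abs_midpoint_sum_sub_arctan_le (x : ℝ) {L : ℕ} (hL : 0 < L) :
    |∑ k ∈ Finset.range L, 1 / (L : ℝ) * (x / (1 + (x * ((2 * k + 1) / (2 * L))) ^ 2)) -
      Real.arctan x| ≤ x ^ 2 / L := by
  have hL' : (0 : ℝ) < L := by exact_mod_cast hL
  have htel : Real.arctan x = ∑ k ∈ Finset.range L,
      (Real.arctan (x * ((k + 1 : ℕ) / L)) - Real.arctan (x * ((k : ℕ) / L))) := by
    rw [Finset.sum_range_sub (fun k : ℕ => Real.arctan (x * ((k : ℝ) / L)))]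
    simp [hL'.ne']
  rw [htel, ← Finset.sum_sub_distrib]
  refine (Finset.abs_sum_le_sum_abs _ _).trans ?_
  calc _ ≤ ∑ _k ∈ Finset.range L, x ^ 2 * (1 / (L : ℝ)) ^ 2 := by
        refine Finset.sum_le_sum fun k _ => ?_
        have hlen : ((k + 1 : ℕ) / L : ℝ) - k / L = 1 / L := by
          push_cast
          ring
        have h := abs_arctan_sub_sub_le x (k / L) ((k + 1 : ℕ) / L) ((2 * k + 1) / (2 * L))
          (by rw [← sub_pos, hlen]; positivity)
          ⟨by rw [div_le_div_iff₀ hL' (by positivity)]; nlinarith,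
            by rw [div_le_div_iff₀ (by positivity) hL']; push_cast; nlinarith⟩
        rwa [hlen] at h
    _ = x ^ 2 / L := by
        rw [Finset.sum_const, Finset.card_range, nsmul_eq_mul]
        field_simp

theorem tendsto_midpoint_sum_arctan (x : ℝ) :
    Tendsto (fun L : ℕ => ∑ k ∈ Finset.range L,
      1 / (L : ℝ) * (x / (1 + (x * ((2 * k + 1) / (2 * L))) ^ 2))) atTop (𝓝 (Real.arctan x)) := by
  rw [tendsto_iff_norm_sub_tendsto_zero]
  refine squeeze_zero' (Eventually.of_forall fun _ => norm_nonneg _) ?_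
    (tendsto_const_div_atTop_nhds_zero_nat (x ^ 2))
  filter_upwards [eventually_gt_atTop 0] with L hL
  exact abs_midpoint_sum_sub_arctan_le x hL

theorem I_mul_inv_sub_inv_eq (x : ℝ) (hx : x ≠ 0) {L : ℕ} (hL : 0 < L) (k : ℕ) :
    I * (1 / ((2 * ((k + 1 : ℕ) : ℂ) - 1) + 2 * I * (L : ℂ) / (x : ℂ)) -
        1 / ((2 * ((k + 1 : ℕ) : ℂ) - 1) - 2 * I * (L : ℂ) / (x : ℂ))) =
      ((1 / (L : ℝ) * (x / (1 + (x * ((2 * k + 1) / (2 * L))) ^ 2)) : ℝ) : ℂ) := by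
  have hL' : (L : ℝ) ≠ 0 := by exact_mod_cast hL.ne'
  have hLc : (L : ℂ) ≠ 0 := by exact_mod_cast hL.ne'
  have hxc : (x : ℂ) ≠ 0 := by exact_mod_cast hx
  have him : (2 * L / x : ℝ) ≠ 0 := by positivity
  have hp : (2 * ((k + 1 : ℕ) : ℂ) - 1) + 2 * I * (L : ℂ) / (x : ℂ) ≠ 0 := by
    intro h
    apply him
    have e : (2 * ((k + 1 : ℕ) : ℂ) - 1) + 2 * I * (L : ℂ) / (x : ℂ) =
      ((2 * (k + 1 : ℕ) - 1 : ℝ) : ℂ) + ((2 * L / x : ℝ) : ℂ) * I := by push_cast; ring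
    rw [e] at h
    simpa only [add_im, ofReal_im, re_ofReal_mul, im_ofReal_mul, I_im, mul_one, zero_add, zero_im]
      using congrArg Complex.im h
  have hm : (2 * ((k + 1 : ℕ) : ℂ) - 1) - 2 * I * (L : ℂ) / (x : ℂ) ≠ 0 := by
    intro h
    apply him
    have e : (2 * ((k + 1 : ℕ) : ℂ) - 1) - 2 * I * (L : ℂ) / (x : ℂ) =
      ((2 * (k + 1 : ℕ) - 1 : ℝ) : ℂ) - ((2 * L / x : ℝ) : ℂ) * I := by push_cast; ring
    rw [e] at h
    simpa only [sub_im, ofReal_im, re_ofReal_mul, im_ofReal_mul, I_im, mul_one, zero_sub, zero_im,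
      neg_eq_zero] using congrArg Complex.im h
  have hden : (1 + ((x : ℂ) * ((2 * k + 1) / (2 * L))) ^ 2) ≠ 0 := by
    have : (1 + (x * ((2 * k + 1) / (2 * L))) ^ 2 : ℝ) ≠ 0 := by positivity
    simpa only [ofReal_add, ofReal_one, ofReal_pow, ofReal_mul, ofReal_div, ofReal_ofNat,
      ofReal_natCast] using ofReal_ne_zero.2 this
  have hprod : ((2 * ((k + 1 : ℕ) : ℂ) - 1) + 2 * I * (L : ℂ) / (x : ℂ)) *
      ((2 * ((k + 1 : ℕ) : ℂ) - 1) - 2 * I * (L : ℂ) / (x : ℂ)) =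
      (2 * L / x) ^ 2 * (1 + ((x : ℂ) * ((2 * k + 1) / (2 * L))) ^ 2) := by
    push_cast
    field_simp
    ring_nf
    simp only [I_sq]
    ring
  rw [div_sub_div _ _ hp hm, hprod]
  push_cast
  field_simp
  ring_nf
  simp only [I_sq]
  ring

theorem norm_one_div_pow_le (a b : ℝ) (hb : b ≠ 0) (n : ℕ) :
    ‖1 / ((a : ℂ) + b * I) ^ n‖ ≤ (1 / |b|) ^ n := by
  have h : |b| ≤ ‖(a : ℂ) + b * I‖ := by
    simpa using abs_im_le_norm ((a : ℂ) + b * I)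
  have hb' : 0 < |b| := abs_pos.2 hb
  rw [norm_div, norm_pow, norm_one, one_div_pow]
  gcongr

theorem tendsto_sum_inv_pow_sub_inv_pow_zero (x : ℝ) (hx : x ≠ 0) (c : ℂ) (n : ℕ) (hn : n ≠ 0) :
    Tendsto (fun L : ℕ => ∑ ℓ ∈ Finset.Icc 1 L, I * (c *
      (1 / ((2 * (ℓ : ℂ) - 1) + 2 * I * (L : ℂ) / (x : ℂ)) ^ (n + 1) -
        1 / ((2 * (ℓ : ℂ) - 1) - 2 * I * (L : ℂ) / (x : ℂ)) ^ (n + 1)))) atTop (𝓝 0) := by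
  have hlim : Tendsto (fun L : ℕ => ‖c‖ * |x| * (|x| / 2 / L) ^ n) atTop (𝓝 0) := by
    have := ((tendsto_const_div_atTop_nhds_zero_nat (|x| / 2)).pow n).const_mul (‖c‖ * |x|)
    simpa [hn] using this
  refine squeeze_zero_norm' ?_ hlim
  filter_upwards [eventually_gt_atTop 0] with L hL
  have hL' : (L : ℝ) ≠ 0 := by exact_mod_cast hL.ne'
  have hb : (2 * L / x : ℝ) ≠ 0 := by positivity
  have habs : 1 / |2 * L / x| = |x| / 2 / L := by
    rw [abs_div, abs_mul, Nat.abs_cast, abs_two]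
    field_simp
  calc _ ≤ ∑ _ℓ ∈ Finset.Icc 1 L, ‖c‖ * (2 * (|x| / 2 / L) ^ (n + 1)) := by
        refine norm_sum_le_of_le _ fun ℓ _ => ?_
        rw [norm_mul, norm_I, one_mul, norm_mul]
        gcongr
        refine (norm_sub_le _ _).trans ?_
        have h₁ := norm_one_div_pow_le (2 * ℓ - 1) (2 * L / x) hb (n + 1)
        have h₂ := norm_one_div_pow_le (2 * ℓ - 1) (-(2 * L / x)) (neg_ne_zero.2 hb) (n + 1)
        rw [abs_neg] at h₂
        rw [habs] at h₁ h₂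
        have e₁ : (2 * (ℓ : ℂ) - 1) + 2 * I * (L : ℂ) / (x : ℂ) =
          ((2 * ℓ - 1 : ℝ) : ℂ) + ((2 * L / x : ℝ) : ℂ) * I := by push_cast; ring
        have e₂ : (2 * (ℓ : ℂ) - 1) - 2 * I * (L : ℂ) / (x : ℂ) =
          ((2 * ℓ - 1 : ℝ) : ℂ) + ((-(2 * L / x) : ℝ) : ℂ) * I := by push_cast; ring
        rw [e₁, e₂]
        linarith
    _ = ‖c‖ * |x| * (|x| / 2 / L) ^ n := by
        rw [Finset.sum_const, Nat.card_Icc, nsmul_eq_mul, Nat.add_sub_cancel, pow_succ]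
        field_simp

theorem tendsto_sum_inv_sub_inv_arctan (x : ℝ) (hx : x ≠ 0) :
    Tendsto (fun L : ℕ => ∑ ℓ ∈ Finset.Icc 1 L, I *
      (1 / ((2 * (ℓ : ℂ) - 1) + 2 * I * (L : ℂ) / (x : ℂ)) -
        1 / ((2 * (ℓ : ℂ) - 1) - 2 * I * (L : ℂ) / (x : ℂ))))
      atTop (𝓝 ((Real.arctan x : ℝ) : ℂ)) := by
  refine ((continuous_ofReal.tendsto _).comp (tendsto_midpoint_sum_arctan x)).congr' ?_
  filter_upwards [eventually_gt_atTop 0] with L hL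
  rw [Function.comp_apply, ofReal_sum, ← Finset.Ico_add_one_right_eq_Icc,
    Finset.sum_Ico_eq_sum_range, Nat.add_sub_cancel]
  refine Finset.sum_congr rfl fun k _ => ?_
  rw [add_comm 1 k]
  exact (I_mul_inv_sub_inv_eq x hx hL k).symm

theorem arctan_eq_lim_complex (M : ℕ) (x : ℝ) (hx : x ≠ 0) :
    Tendsto
      (fun L : ℕ =>
        I * ∑ ℓ ∈ Finset.Icc 1 L, ∑ m ∈ Finset.Icc 1 (M / 2 + 1),
          (1 / (2 * (m : ℂ) - 1)) *
            (1 / ((2 * (ℓ : ℂ) - 1) + 2 * I * (L : ℂ) / (x : ℂ)) ^ (2 * m - 1) -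
              1 / ((2 * (ℓ : ℂ) - 1) - 2 * I * (L : ℂ) / (x : ℂ)) ^ (2 * m - 1)))
      atTop (𝓝 ((Real.arctan x : ℝ) : ℂ)) := by
  simp_rw [Finset.mul_sum]
  simp_rw [Finset.sum_comm (t := Finset.Icc 1 (M / 2 + 1))]
  have hsum : ((Real.arctan x : ℝ) : ℂ) =
      ∑ m ∈ Finset.Icc 1 (M / 2 + 1), if m = 1 then ((Real.arctan x : ℝ) : ℂ) else 0 := by
    simp
  rw [hsum]
  refine tendsto_finsetSum _ fun m hm => ?_
  split_ifs with h
  · subst h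
    have := tendsto_sum_inv_sub_inv_arctan x hx
    norm_num at this ⊢
    exact this
  · have hm1 := (Finset.mem_Icc.1 hm).1
    obtain ⟨n, rfl⟩ : ∃ n, m = n + 2 := ⟨m - 2, by omega⟩
    exact tendsto_sum_inv_pow_sub_inv_pow_zero x hx _ (2 * n + 2) (by omega)
end

section
/- Let M ≥ 0 be a fixed natural number. Then π = lim_{L→∞} 4 · Σ_{ℓ=1}^{L} Σ_{m=0}^{M} ( ((-1)^m + 1) / ( (2L)^(m+1) (m+1)! ) ) · g_{ℓ,m}, where g_{ℓ,m} is the m-th derivative of the function t ↦ 1/(1 + t²) evaluated at t = (ℓ - 1/2)/L, and the limit is taken over positive integers L. -/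
open Filter Topology

theorem midpoint_mem_Icc {L ℓ : ℕ} (hℓ : ℓ ∈ Finset.Icc 1 L) :
    ((ℓ : ℝ) - 1 / 2) / (L : ℝ) ∈ Set.Icc (0 : ℝ) 1 := by
  obtain ⟨h1, h2⟩ := Finset.mem_Icc.mp hℓ
  have h1' : (1 : ℝ) ≤ ℓ := by exact_mod_cast h1
  have h2' : (ℓ : ℝ) ≤ L := by exact_mod_cast h2
  exact ⟨div_nonneg (by linarith) (by linarith), (div_le_one (by linarith)).mpr (by linarith)⟩

theorem abs_one_div_one_add_sq_sub_le (a b : ℝ) :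
    |1 / (1 + a ^ 2) - 1 / (1 + b ^ 2)| ≤ |a - b| := by
  have ha : 0 < 1 + a ^ 2 := by positivity
  have hb : 0 < 1 + b ^ 2 := by positivity
  have h : 1 / (1 + a ^ 2) - 1 / (1 + b ^ 2) =
      (b - a) * ((b + a) / ((1 + a ^ 2) * (1 + b ^ 2))) := by
    field_simp
    ring
  have h' : |(b + a) / ((1 + a ^ 2) * (1 + b ^ 2))| ≤ 1 := by
    rw [abs_div, abs_of_pos (mul_pos ha hb), div_le_one (mul_pos ha hb), abs_le]
    constructor <;> nlinarith [sq_nonneg (a + 1), sq_nonneg (b + 1), sq_nonneg (a - 1),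
      sq_nonneg (b - 1), sq_nonneg (a * b)]
  rw [h, abs_mul, abs_sub_comm b a]
  exact mul_le_of_le_one_right (abs_nonneg _) h'

/-- Midpoint sums of a Lipschitz function converge to the increment of its primitive. -/
theorem tendsto_midpoint_sum_s14 {F f : ℝ → ℝ} {K : ℝ} (hF : ∀ x, HasDerivAt F (f x) x)
    (hf : ∀ a b, |f a - f b| ≤ K * |a - b|) :
    Tendsto (fun L : ℕ => ∑ ℓ ∈ Finset.Icc 1 L, 1 / (L : ℝ) * f (((ℓ : ℝ) - 1 / 2) / (L : ℝ)))
      atTop (𝓝 (F 1 - F 0)) := by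
  have hK : 0 ≤ K := by simpa using (abs_nonneg _).trans (hf 1 0)
  rw [tendsto_iff_norm_sub_tendsto_zero]
  refine squeeze_zero' (Eventually.of_forall fun _ => norm_nonneg _) ?_
    (tendsto_const_div_atTop_nhds_zero_nat K)
  filter_upwards [eventually_gt_atTop 0] with L hL
  have hL' : (0 : ℝ) < L := by exact_mod_cast hL
  have htel : F 1 - F 0 =
      ∑ ℓ ∈ Finset.Icc 1 L, (F ((ℓ : ℝ) / L) - F (((ℓ : ℝ) - 1) / L)) := by
    rw [← Finset.Ico_add_one_right_eq_Icc, Finset.sum_Ico_eq_sum_range, Nat.add_sub_cancel]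
    have := Finset.sum_range_sub (fun n : ℕ => F ((n : ℝ) / L)) L
    simp only [div_self hL'.ne', Nat.cast_zero, zero_div] at this
    rw [← this]
    refine Finset.sum_congr rfl fun i _ => ?_
    push_cast
    ring_nf
  rw [htel, ← Finset.sum_sub_distrib]
  refine (norm_sum_le_of_le (Finset.Icc 1 L) (n := fun _ => K / (L : ℝ) ^ 2) ?_).trans ?_
  · intro ℓ _
    have hlt : ((ℓ : ℝ) - 1) / L < ℓ / L := by gcongr; linarith
    obtain ⟨c, ⟨hc1, hc2⟩, hc⟩ := exists_hasDerivAt_eq_slope F f hlt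
      (fun x _ => (hF x).continuousAt.continuousWithinAt) (fun x _ => hF x)
    have hw : (ℓ : ℝ) / L - ((ℓ : ℝ) - 1) / L = 1 / L := by ring
    rw [hw, eq_div_iff (by positivity)] at hc
    rw [← hc, mul_comm (f c), ← mul_sub, Real.norm_eq_abs, abs_mul,
      abs_of_pos (by positivity : (0 : ℝ) < 1 / L)]
    have hd : |((ℓ : ℝ) - 1 / 2) / L - c| ≤ 1 / L := by
      have h1 : ((ℓ : ℝ) - 1) / L ≤ ((ℓ : ℝ) - 1 / 2) / L := by gcongr; norm_num
      have h2 : ((ℓ : ℝ) - 1 / 2) / L ≤ ℓ / L := by gcongr; linarith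
      rw [abs_le]
      constructor <;> linarith
    calc 1 / (L : ℝ) * |f (((ℓ : ℝ) - 1 / 2) / L) - f c|
        ≤ 1 / (L : ℝ) * (K * (1 / L)) := by
          gcongr
          exact (hf _ _).trans (by gcongr)
      _ = K / (L : ℝ) ^ 2 := by ring
  · simp only [Finset.sum_const, Nat.card_Icc, Nat.add_sub_cancel, nsmul_eq_mul]
    apply le_of_eq
    field_simp

/-- A midpoint sum of a function bounded on the unit interval vanishes in the limit when weighted
by a power of the step of exponent at least two. -/
theorem tendsto_sum_mul_midpoint_zero {g : ℝ → ℝ} (hg : ContinuousOn g (Set.Icc 0 1)) {m : ℕ}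
    (hm : m ≠ 0) (a b : ℝ) :
    Tendsto (fun L : ℕ => ∑ ℓ ∈ Finset.Icc 1 L,
      a / ((2 * (L : ℝ)) ^ (m + 1) * b) * g (((ℓ : ℝ) - 1 / 2) / (L : ℝ))) atTop (𝓝 0) := by
  obtain ⟨C, hC⟩ := isCompact_Icc.exists_bound_of_continuousOn hg
  have hlim : Tendsto (fun L : ℕ => |a / (2 ^ (m + 1) * b)| * C * (1 / (L : ℝ)) ^ m) atTop
      (𝓝 0) := by
    simpa [hm] using ((tendsto_one_div_atTop_nhds_zero_nat (𝕜 := ℝ)).pow m).const_mul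
      (|a / (2 ^ (m + 1) * b)| * C)
  refine squeeze_zero_norm' ?_ hlim
  filter_upwards [eventually_gt_atTop 0] with L hL
  have hL' : (0 : ℝ) < L := by exact_mod_cast hL
  refine (norm_sum_le_of_le (Finset.Icc 1 L)
    (n := fun _ => |a / ((2 * (L : ℝ)) ^ (m + 1) * b)| * C) fun ℓ hℓ => ?_).trans (le_of_eq ?_)
  · rw [norm_mul, Real.norm_eq_abs (_ / _)]
    gcongr
    exact hC _ (midpoint_mem_Icc hℓ)
  · have h : a / ((2 * (L : ℝ)) ^ (m + 1) * b) = a / (2 ^ (m + 1) * b) * (1 / (L : ℝ)) ^ (m + 1) := by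
      rw [mul_pow, one_div, inv_pow, ← div_eq_mul_inv, div_div]
      ring_nf
    rw [h, abs_mul, abs_of_pos (by positivity : (0 : ℝ) < (1 / (L : ℝ)) ^ (m + 1))]
    simp only [Finset.sum_const, Nat.card_Icc, Nat.add_sub_cancel, nsmul_eq_mul]
    rw [pow_succ (1 / (L : ℝ))]
    field_simp

theorem pi_eq_lim_derivs (M : ℕ) :
    Tendsto
      (fun L : ℕ =>
        4 * ∑ ℓ ∈ Finset.Icc 1 L, ∑ m ∈ Finset.range (M + 1),
          (((-1 : ℝ) ^ m + 1) / ((2 * (L : ℝ)) ^ (m + 1) * ((m + 1).factorial : ℝ))) *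
            iteratedDeriv m (fun t : ℝ => 1 / (1 + t ^ 2))
              (((ℓ : ℝ) - 1 / 2) / (L : ℝ)))
      atTop (𝓝 Real.pi) := by
  have hsmooth : ContDiff ℝ ⊤ (fun t : ℝ => 1 / (1 + t ^ 2)) :=
    contDiff_const.div (by fun_prop) fun t => by positivity
  have hpi : Real.pi = 4 * ∑ m ∈ Finset.range (M + 1), if m = 0 then Real.pi / 4 else 0 := by
    rw [Finset.sum_ite_eq' (Finset.range (M + 1)) 0 fun _ => Real.pi / 4]
    simp
    ring
  conv_rhs => rw [hpi]
  simp only [Finset.sum_comm (t := Finset.range (M + 1))]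
  refine (tendsto_finsetSum _ fun m _ => ?_).const_mul 4
  split_ifs with hm
  · subst hm
    have h := tendsto_midpoint_sum_s14 (K := 1) Real.hasDerivAt_arctan
      (by simpa using abs_one_div_one_add_sq_sub_le)
    rw [Real.arctan_one, Real.arctan_zero, sub_zero] at h
    refine h.congr fun L => Finset.sum_congr rfl fun ℓ _ => ?_
    simp only [iteratedDeriv_zero]
    congr 1
    norm_num [div_mul_eq_div_div]
  · exact tendsto_sum_mul_midpoint_zero
      (hsmooth.continuous_iteratedDeriv m (by simp)).continuousOn hm _ _
end
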